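/- Let 1 ≤ p < ∞, let h ∈ H^p(𝔻), let ψ : 𝔻 → 𝔻 be holomorphic, and suppose the weighted composition operator W_{h,ψ} is bounded on H^p. Then W_{h,ψ} is bounded below if and only if there exists a constant C > 0 such that ‖W_{h,ψ} ℓ_w‖_p ≥ C for all w ∈ 𝔻, where ℓ_w(z) = (1 - |w|²)^{1/p} / (1 - w̄ z)^{2/p}. -/

import Mathlib

open MeasureTheory Metric Complex

noncomputable section

/-- Normalized Lebesgue (arc length) measure on the unit circle `𝕋`, as a Borel measure on `ℂ`. -/
def circleM : Measure ℂ :=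
  (ENNReal.ofReal (2 * Real.pi))⁻¹ •
    (volume.restrict (Set.Ioc (0 : ℝ) (2 * Real.pi))).map
      (fun θ : ℝ => Complex.exp (θ * Complex.I))

/-- The Hardy space `p`-norm of a function on the unit disc, namely
`sup_{0 ≤ r < 1} (∫_𝕋 ‖f (r ζ)‖^p dm(ζ))^{1/p}`. -/
def hardyNorm (p : ℝ) (f : ℂ → ℂ) : ℝ :=
  ⨆ r : Set.Ico (0 : ℝ) 1, (∫ ζ, ‖f (((r : ℝ) : ℂ) * ζ)‖ ^ p ∂circleM) ^ (1 / p)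

/-- Membership in the Hardy space `H^p` of the unit disc: `f` is holomorphic on `𝔻` and its
`p`-means over circles of radius `r < 1` are uniformly bounded. -/
def MemHp (p : ℝ) (f : ℂ → ℂ) : Prop :=
  DifferentiableOn ℂ f (ball (0 : ℂ) 1) ∧
    BddAbove (Set.range fun r : Set.Ico (0 : ℝ) 1 =>
      (∫ ζ, ‖f (((r : ℝ) : ℂ) * ζ)‖ ^ p ∂circleM) ^ (1 / p))

/-- The reproducing kernel of the Hardy space: `k_λ(z) = 1/(1 - conj λ * z)`. -/
def kern (l z : ℂ) : ℂ := (1 - (starRingEnd ℂ) l * z)⁻¹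

/-- The Hardy-space test function `ℓ_w(z) = (1-|w|²)^{1/p} / (1 - conj w · z)^{2/p}`,
which has `‖ℓ_w‖_{H^p} = 1` for every `w ∈ 𝔻`. -/
def ellH (p : ℝ) (w z : ℂ) : ℂ :=
  (((1 - ‖w‖ ^ 2) ^ (1 / p) : ℝ) : ℂ) / (1 - (starRingEnd ℂ) w * z) ^ (((2 / p : ℝ)) : ℂ)

lemma measurable_exp_mul_I : Measurable fun θ : ℝ => Complex.exp (θ * Complex.I) := by
  fun_prop

instance : IsProbabilityMeasure circleM := by
  refine ⟨?_⟩
  rw [circleM, Measure.smul_apply, Measure.map_apply measurable_exp_mul_I MeasurableSet.univ]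
  have h2 : (0 : ℝ) < 2 * Real.pi := by positivity
  simp only [Set.preimage_univ, Measure.restrict_apply_univ, Real.volume_Ioc, sub_zero,
    smul_eq_mul]
  exact ENNReal.inv_mul_cancel (by simpa using Real.pi_pos) ENNReal.ofReal_ne_top

lemma ae_mem_sphere_circleM : ∀ᵐ ζ ∂circleM, ζ ∈ sphere (0 : ℂ) 1 := by
  refine Measure.ae_smul_measure ?_ _
  refine (ae_map_iff (p := fun ζ => ζ ∈ sphere (0 : ℂ) 1) measurable_exp_mul_I.aemeasurable
    isClosed_sphere.measurableSet).2 ?_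
  exact ae_of_all _ fun θ => by simp [Complex.norm_exp_ofReal_mul_I]

lemma circleM_restrict_sphere : circleM.restrict (sphere (0 : ℂ) 1) = circleM :=
  Measure.restrict_eq_self_of_ae_mem ae_mem_sphere_circleM

lemma ae_circleM_of_forall {P : ℂ → Prop} (hP : ∀ ζ : ℂ, ‖ζ‖ = 1 → P ζ) :
    ∀ᵐ ζ ∂circleM, P ζ :=
  ae_mem_sphere_circleM.mono fun ζ hζ => hP ζ (by simpa using hζ)

section

variable {E : Type*} [NormedAddCommGroup E]

lemma integrable_circleM {f : ℂ → E} (hf : ContinuousOn f (sphere (0 : ℂ) 1)) :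
    Integrable f circleM := by
  rw [← circleM_restrict_sphere]
  exact hf.integrableOn_compact (isCompact_sphere _ _)

lemma integrable_circleM_prod {f : ℂ × ℂ → E}
    (hf : ContinuousOn f (sphere (0 : ℂ) 1 ×ˢ sphere (0 : ℂ) 1)) :
    Integrable f (circleM.prod circleM) := by
  rw [← circleM_restrict_sphere, Measure.prod_restrict]
  exact hf.integrableOn_compact ((isCompact_sphere _ _).prod (isCompact_sphere _ _))

variable [NormedSpace ℝ E]

lemma integral_circleM_congr {f g : ℂ → E} (h : ∀ ζ : ℂ, ‖ζ‖ = 1 → f ζ = g ζ) :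
    ∫ ζ, f ζ ∂circleM = ∫ ζ, g ζ ∂circleM :=
  integral_congr_ae (ae_circleM_of_forall h)

lemma integral_circleM_eq_circleAverage {f : ℂ → E} (hf : ContinuousOn f (sphere (0 : ℂ) 1)) :
    ∫ ζ, f ζ ∂circleM = Real.circleAverage f 0 1 := by
  have h2 : (0 : ℝ) < 2 * Real.pi := by positivity
  have hm := (integrable_circleM hf).aestronglyMeasurable
  rw [circleM] at hm ⊢
  have hm' := hm.mono_ac (Measure.absolutelyContinuous_smul
    (ENNReal.inv_ne_zero.2 (ENNReal.ofReal_ne_top (r := 2 * Real.pi))))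
  rw [integral_smul_measure, integral_map measurable_exp_mul_I.aemeasurable hm',
    Real.circleAverage_def, intervalIntegral.integral_of_le h2.le, ENNReal.toReal_inv,
    ENNReal.toReal_ofReal h2.le]
  simp [circleMap]

end

lemma integral_circleM_mono {f g : ℂ → ℝ} (hf : ContinuousOn f (sphere (0 : ℂ) 1))
    (hg : ContinuousOn g (sphere (0 : ℂ) 1)) (h : ∀ ζ : ℂ, ‖ζ‖ = 1 → f ζ ≤ g ζ) :
    ∫ ζ, f ζ ∂circleM ≤ ∫ ζ, g ζ ∂circleM :=
  integral_mono_ae (integrable_circleM hf) (integrable_circleM hg) (ae_circleM_of_forall h)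

/-- The Poisson kernel of the unit disc. -/
def discPoisson (w ζ : ℂ) : ℝ := (1 - ‖w‖ ^ 2) / ‖ζ - w‖ ^ 2

lemma sub_ne_zero_of_norm {w ζ : ℂ} (hw : ‖w‖ < 1) (hζ : ‖ζ‖ = 1) : ζ - w ≠ 0 := by
  rintro h
  rw [sub_eq_zero.1 h] at hζ
  exact hw.ne hζ

lemma discPoisson_nonneg {w ζ : ℂ} (hw : ‖w‖ < 1) : 0 ≤ discPoisson w ζ := by
  have : 0 ≤ 1 - ‖w‖ ^ 2 := by nlinarith [norm_nonneg w]
  exact div_nonneg this (by positivity)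

lemma continuousOn_discPoisson {X : Type*} [TopologicalSpace X] {s : Set X} {a b : X → ℂ}
    (ha : ContinuousOn a s) (hb : ContinuousOn b s) (ha1 : ∀ x ∈ s, ‖a x‖ < 1)
    (hb1 : ∀ x ∈ s, ‖b x‖ = 1) : ContinuousOn (fun x => discPoisson (a x) (b x)) s := by
  unfold discPoisson
  refine ContinuousOn.div (by fun_prop) (by fun_prop) fun x hx => ?_
  have := sub_ne_zero_of_norm (ha1 x hx) (hb1 x hx)
  positivity

lemma discPoisson_mul_comm {r : ℝ} {ζ η : ℂ} (hζ : ‖ζ‖ = 1) (hη : ‖η‖ = 1) :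
    discPoisson (r * ζ) η = discPoisson (r * η) ζ := by
  have h : ‖η - r * ζ‖ ^ 2 = ‖ζ - r * η‖ ^ 2 := by
    have h1 : ζ.re ^ 2 + ζ.im ^ 2 = 1 := by
      rw [← Complex.sq_norm_sub_sq_im, hζ]; ring
    have h2 : η.re ^ 2 + η.im ^ 2 = 1 := by
      rw [← Complex.sq_norm_sub_sq_im, hη]; ring
    rw [← Complex.normSq_eq_norm_sq, ← Complex.normSq_eq_norm_sq, Complex.normSq_apply,
      Complex.normSq_apply]
    simp
    linear_combination (r ^ 2 - 1) * h1 - (r ^ 2 - 1) * h2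
  simp [discPoisson, h, hζ, hη]

lemma poisson_integral {F : ℂ → ℂ} (hF : DiffContOnCl ℂ F (ball (0 : ℂ) 1)) {w : ℂ}
    (hw : ‖w‖ < 1) : ∫ ζ, discPoisson w ζ • F ζ ∂circleM = F w := by
  have hw' : w ∈ ball (0 : ℂ) 1 := by simpa using hw
  rw [← hF.circleAverage_poissonKernel_smul hw', integral_circleM_eq_circleAverage]
  · refine Real.circleAverage_congr_sphere fun z hz => ?_
    have hz : ‖z‖ = 1 := by simpa using hz
    simp [discPoisson, poissonKernel_def, hz]
  · have h1 : ContinuousOn F (sphere (0 : ℂ) 1) :=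
      hF.continuousOn_ball.mono sphere_subset_closedBall
    exact (continuousOn_discPoisson continuousOn_const continuousOn_id (fun _ _ => hw)
      (by simp)).smul h1

lemma integral_discPoisson {w : ℂ} (hw : ‖w‖ < 1) : ∫ ζ, discPoisson w ζ ∂circleM = 1 := by
  have h := poisson_integral (F := fun _ => 1) diffContOnCl_const hw
  simp only [Complex.real_smul, mul_one] at h
  rw [integral_complex_ofReal] at h
  exact_mod_cast h

lemma integral_discPoisson_left {r : ℝ} (hr0 : 0 ≤ r) (hr : r < 1) {η : ℂ} (hη : ‖η‖ = 1) :
    ∫ ζ, discPoisson (r * ζ) η ∂circleM = 1 := by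
  rw [← integral_discPoisson (w := r * η) (by simpa [hη, abs_of_nonneg hr0] using hr)]
  exact integral_circleM_congr fun ζ hζ => discPoisson_mul_comm hζ hη

/-- The integral of `‖f‖ ^ p` over the circle of radius `s`. -/
def circleMean (p : ℝ) (f : ℂ → ℂ) (s : ℝ) : ℝ := ∫ ζ, ‖f (s * ζ)‖ ^ p ∂circleM

lemma continuousOn_dilate {f : ℂ → ℂ} (hf : DifferentiableOn ℂ f (ball (0 : ℂ) 1)) {s : ℝ}
    (hs0 : 0 ≤ s) (hs : s < 1) : ContinuousOn (fun z : ℂ => f (s * z)) (closedBall (0 : ℂ) 1) := by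
  refine hf.continuousOn.comp (by fun_prop) fun z hz => ?_
  have hz : ‖z‖ ≤ 1 := by simpa using hz
  simp only [mem_ball_zero_iff, norm_mul, Complex.norm_real, Real.norm_eq_abs, abs_of_nonneg hs0]
  nlinarith [norm_nonneg z]

lemma continuousOn_norm_rpow_dilate {p : ℝ} (hp : 1 ≤ p) {f : ℂ → ℂ}
    (hf : DifferentiableOn ℂ f (ball (0 : ℂ) 1)) {s : ℝ} (hs0 : 0 ≤ s) (hs : s < 1) :
    ContinuousOn (fun z : ℂ => ‖f (s * z)‖ ^ p) (sphere (0 : ℂ) 1) :=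
  (((continuousOn_dilate hf hs0 hs).mono sphere_subset_closedBall).norm).rpow_const
    fun _ _ => Or.inr (by linarith)

lemma diffContOnCl_dilate {f : ℂ → ℂ} (hf : DifferentiableOn ℂ f (ball (0 : ℂ) 1)) {s : ℝ}
    (hs0 : 0 ≤ s) (hs : s < 1) : DiffContOnCl ℂ (fun z : ℂ => f (s * z)) (ball (0 : ℂ) 1) := by
  refine ⟨hf.comp (by fun_prop) fun z hz => ?_, ?_⟩
  · have hz : ‖z‖ < 1 := by simpa using hz
    simp only [mem_ball_zero_iff, norm_mul, Complex.norm_real, Real.norm_eq_abs,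
      abs_of_nonneg hs0]
    nlinarith [norm_nonneg z]
  · rw [closure_ball _ one_ne_zero]
    exact continuousOn_dilate hf hs0 hs

lemma circleMean_nonneg {p : ℝ} {f : ℂ → ℂ} {s : ℝ} : 0 ≤ circleMean p f s :=
  integral_nonneg fun _ => by positivity

lemma tangent_le_rpow {p a x : ℝ} (hp : 1 ≤ p) (ha : 0 ≤ a) (hx : 0 ≤ x) :
    a ^ p + p * a ^ (p - 1) * (x - a) ≤ x ^ p := by
  rcases ha.eq_or_lt with rfl | ha
  · rcases hp.eq_or_lt with rfl | hp
    · simp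
    · rw [Real.zero_rpow (by linarith), Real.zero_rpow (by linarith)]
      simpa using Real.rpow_nonneg hx p
  · have hx' := div_nonneg hx ha.le
    have h := one_add_mul_self_le_rpow_one_add (s := x / a - 1) (by linarith) hp
    rw [add_sub_cancel, Real.div_rpow hx ha.le, le_div_iff₀ (Real.rpow_pos_of_pos ha p)] at h
    refine le_trans (le_of_eq ?_) h
    have : a ^ p = a ^ (p - 1) * a := by
      rw [← Real.rpow_add_one ha.ne', sub_add_cancel]
    rw [this]
    field_simp

lemma norm_rpow_le_integral_discPoisson {p : ℝ} (hp : 1 ≤ p) {F : ℂ → ℂ}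
    (hF : DiffContOnCl ℂ F (ball (0 : ℂ) 1)) {w : ℂ} (hw : ‖w‖ < 1) :
    ‖F w‖ ^ p ≤ ∫ ζ, discPoisson w ζ * ‖F ζ‖ ^ p ∂circleM := by
  have hc : ContinuousOn F (sphere (0 : ℂ) 1) :=
    hF.continuousOn_ball.mono sphere_subset_closedBall
  have hP : ContinuousOn (fun ζ => discPoisson w ζ) (sphere (0 : ℂ) 1) :=
    continuousOn_discPoisson continuousOn_const continuousOn_id (fun _ _ => hw) (by simp)
  have hcp : ContinuousOn (fun ζ => ‖F ζ‖ ^ p) (sphere (0 : ℂ) 1) :=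
    hc.norm.rpow_const fun _ _ => Or.inr (by linarith)
  have h1 : ‖F w‖ ≤ ∫ ζ, discPoisson w ζ * ‖F ζ‖ ∂circleM := by
    rw [← poisson_integral hF hw]
    refine (norm_integral_le_integral_norm _).trans_eq (integral_congr_ae (ae_of_all _ fun ζ => ?_))
    simp [abs_of_nonneg (discPoisson_nonneg hw)]
  set a := ‖F w‖ with ha
  have ha0 : 0 ≤ a := norm_nonneg _
  have h2 : ∫ ζ, (discPoisson w ζ * (a ^ p - p * a ^ (p - 1) * a) +
      p * a ^ (p - 1) * (discPoisson w ζ * ‖F ζ‖)) ∂circleM ≤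
      ∫ ζ, discPoisson w ζ * ‖F ζ‖ ^ p ∂circleM := by
    refine integral_circleM_mono ?_ (hP.mul hcp) fun ζ _ => ?_
    · exact (hP.mul continuousOn_const).add (continuousOn_const.mul (hP.mul hc.norm))
    · have := mul_le_mul_of_nonneg_left (tangent_le_rpow hp ha0 (norm_nonneg (F ζ)))
        (discPoisson_nonneg (ζ := ζ) hw)
      linarith
  have i1 : Integrable (fun ζ => discPoisson w ζ * (a ^ p - p * a ^ (p - 1) * a)) circleM :=
    integrable_circleM (hP.mul continuousOn_const)
  have i2 : Integrable (fun ζ => p * a ^ (p - 1) * (discPoisson w ζ * ‖F ζ‖)) circleM :=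
    integrable_circleM (continuousOn_const.mul (hP.mul hc.norm))
  rw [integral_add i1 i2, integral_mul_const,
    integral_const_mul, integral_discPoisson hw] at h2
  have h3 : 0 ≤ p * a ^ (p - 1) := mul_nonneg (by linarith) (Real.rpow_nonneg ha0 _)
  nlinarith [mul_le_mul_of_nonneg_left h1 h3]

lemma circleMean_mono {p : ℝ} (hp : 1 ≤ p) {f : ℂ → ℂ}
    (hf : DifferentiableOn ℂ f (ball (0 : ℂ) 1)) {s t : ℝ} (hs : 0 ≤ s) (hst : s ≤ t)
    (ht : t < 1) : circleMean p f s ≤ circleMean p f t := by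
  rcases hst.eq_or_lt with rfl | hst
  · rfl
  have ht0 : 0 < t := hs.trans_lt hst
  set σ := s / t with hσ
  have hσ0 : 0 ≤ σ := div_nonneg hs ht0.le
  have hσ1 : σ < 1 := (div_lt_one ht0).2 hst
  have hnorm : ∀ ζ : ℂ, ‖ζ‖ = 1 → ‖(σ : ℂ) * ζ‖ < 1 := fun ζ hζ => by
    simpa [hζ, abs_of_nonneg hσ0] using hσ1
  have hst' : ∀ ζ : ℂ, (s : ℂ) * ζ = t * (σ * ζ) := fun ζ => by
    have : (t : ℂ) ≠ 0 := by exact_mod_cast ht0.ne'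
    rw [hσ]; push_cast; field_simp
  have hcf := continuousOn_norm_rpow_dilate hp hf ht0.le ht
  have hInt : Integrable (fun q : ℂ × ℂ => discPoisson (σ * q.1) q.2 * ‖f (t * q.2)‖ ^ p)
      (circleM.prod circleM) := by
    refine integrable_circleM_prod (ContinuousOn.mul ?_ ?_)
    · exact continuousOn_discPoisson (by fun_prop) (by fun_prop)
        (fun x hx => hnorm _ (by simpa using hx.1)) (fun x hx => by simpa using hx.2)
    · exact hcf.comp continuousOn_snd fun x hx => hx.2
  calc circleMean p f s
      ≤ ∫ ζ, ∫ η, discPoisson (σ * ζ) η * ‖f (t * η)‖ ^ p ∂circleM ∂circleM := by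
        refine integral_mono_ae (integrable_circleM
          (continuousOn_norm_rpow_dilate hp hf hs (hst.trans ht))) hInt.integral_prod_left ?_
        refine ae_circleM_of_forall fun ζ hζ => ?_
        simp only [hst']
        exact norm_rpow_le_integral_discPoisson hp (diffContOnCl_dilate hf ht0.le ht)
          (hnorm ζ hζ)
    _ = ∫ η, ∫ ζ, discPoisson (σ * ζ) η * ‖f (t * η)‖ ^ p ∂circleM ∂circleM :=
        integral_integral_swap hInt
    _ = circleMean p f t := by
        refine integral_circleM_congr fun η hη => ?_
        rw [integral_mul_const, integral_discPoisson_left hσ0 hσ1 hη, one_mul]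

lemma circleMean_le_of_bound {p B : ℝ} (hp : 1 ≤ p) {f : ℂ → ℂ}
    (hf : DifferentiableOn ℂ f (ball (0 : ℂ) 1)) {s : ℝ} (hs0 : 0 ≤ s) (hs : s < 1)
    (hB : ∀ ζ : ℂ, ‖ζ‖ = 1 → ‖f (s * ζ)‖ ^ p ≤ B) : circleMean p f s ≤ B := by
  have := integral_circleM_mono (continuousOn_norm_rpow_dilate hp hf hs0 hs)
    (continuousOn_const (c := B)) hB
  simpa [circleMean] using this

lemma norm_mul_lt_one {s : ℝ} (hs0 : 0 ≤ s) (hs : s < 1) {z : ℂ} (hz : ‖z‖ ≤ 1) :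
    ‖(s : ℂ) * z‖ < 1 := by
  simp only [norm_mul, Complex.norm_real, Real.norm_eq_abs, abs_of_nonneg hs0]
  nlinarith [norm_nonneg z]

section

variable {p : ℝ} {f g : ℂ → ℂ}

lemma circleMean_rpow_le_hardyNorm (hf : MemHp p f) {s : ℝ} (hs0 : 0 ≤ s) (hs : s < 1) :
    circleMean p f s ^ (1 / p) ≤ hardyNorm p f :=
  le_ciSup hf.2 (⟨s, hs0, hs⟩ : Set.Ico (0 : ℝ) 1)

lemma hardyNorm_nonneg : 0 ≤ hardyNorm p f :=
  Real.iSup_nonneg fun _ => Real.rpow_nonneg circleMean_nonneg _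

lemma circleMean_le_hardyNorm_rpow (hp : 1 ≤ p) (hf : MemHp p f) {s : ℝ} (hs0 : 0 ≤ s)
    (hs : s < 1) : circleMean p f s ≤ hardyNorm p f ^ p := by
  have h := Real.rpow_le_rpow (Real.rpow_nonneg circleMean_nonneg _)
    (circleMean_rpow_le_hardyNorm hf hs0 hs) (by linarith : 0 ≤ p)
  rwa [← Real.rpow_mul circleMean_nonneg, one_div, inv_mul_cancel₀ (by linarith),
    Real.rpow_one] at h

lemma hardyNorm_le_of_circleMean_le (hp : 1 ≤ p) {B : ℝ} (hB : 0 ≤ B)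
    (h : ∀ s : ℝ, 0 ≤ s → s < 1 → circleMean p f s ≤ B ^ p) : hardyNorm p f ≤ B := by
  refine Real.iSup_le (fun s => ?_) hB
  have := Real.rpow_le_rpow circleMean_nonneg (h s s.2.1 s.2.2) (by positivity : 0 ≤ 1 / p)
  rwa [← Real.rpow_mul hB, mul_one_div_cancel (by linarith), Real.rpow_one] at this

lemma memHp_of_circleMean_le (hp : 1 ≤ p) {B : ℝ} (hf : DifferentiableOn ℂ f (ball (0 : ℂ) 1))
    (h : ∀ s : ℝ, 0 ≤ s → s < 1 → circleMean p f s ≤ B) : MemHp p f := by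
  refine ⟨hf, B ^ (1 / p), ?_⟩
  rintro _ ⟨s, rfl⟩
  exact Real.rpow_le_rpow circleMean_nonneg (h s s.2.1 s.2.2) (by positivity)

lemma memHp_of_bounded (hp : 1 ≤ p) {B : ℝ} (hf : DifferentiableOn ℂ f (ball (0 : ℂ) 1))
    (hB : ∀ z : ℂ, ‖z‖ < 1 → ‖f z‖ ≤ B) : MemHp p f :=
  memHp_of_circleMean_le (B := B ^ p) hp hf fun _ hs0 hs =>
    circleMean_le_of_bound hp hf hs0 hs fun _ hζ =>
      Real.rpow_le_rpow (norm_nonneg _) (hB _ (norm_mul_lt_one hs0 hs hζ.le)) (by linarith)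

lemma exists_lt_circleMean (hp : 1 ≤ p) {c C : ℝ} (hC : 0 < C) (hCf : C ≤ hardyNorm p f)
    (hc : c < C ^ p) : ∃ s : ℝ, 0 ≤ s ∧ s < 1 ∧ c < circleMean p f s := by
  by_contra! H
  rcases lt_or_ge c 0 with hc0 | hc0
  · exact absurd (circleMean_nonneg.trans (H 0 le_rfl one_pos)) (by linarith)
  have h := hardyNorm_le_of_circleMean_le (p := p) (f := f) (B := c ^ (1 / p)) hp
    (Real.rpow_nonneg hc0 _) fun s hs0 hs => by
      rw [← Real.rpow_mul hc0, one_div, inv_mul_cancel₀ (by linarith), Real.rpow_one]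
      exact H s hs0 hs
  have h2 := Real.rpow_le_rpow hC.le (hCf.trans h) (by linarith : 0 ≤ p)
  rw [← Real.rpow_mul hc0, one_div, inv_mul_cancel₀ (by linarith), Real.rpow_one] at h2
  linarith

end

lemma norm_one_sub_conj_mul {z ω : ℂ} (hω : ‖ω‖ = 1) (r : ℝ) :
    ‖1 - (starRingEnd ℂ) (r * ω) * z‖ = ‖ω - r * z‖ := by
  have h : ω * (starRingEnd ℂ) ω = 1 := by
    simp [Complex.mul_conj, Complex.normSq_eq_norm_sq, hω]
  calc ‖1 - (starRingEnd ℂ) (r * ω) * z‖ = ‖ω‖ * ‖1 - (starRingEnd ℂ) (r * ω) * z‖ := by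
        rw [hω, one_mul]
    _ = ‖ω - r * z‖ := by
        rw [← norm_mul]
        congr 1
        simp only [map_mul, Complex.conj_ofReal]
        linear_combination (- r * z) * h

lemma norm_one_sub_conj_mul' {w ζ : ℂ} (hζ : ‖ζ‖ = 1) :
    ‖1 - (starRingEnd ℂ) w * ζ‖ = ‖ζ - w‖ := by
  have h : (starRingEnd ℂ) ζ * ζ = 1 := by
    rw [mul_comm, Complex.mul_conj, Complex.normSq_eq_norm_sq, hζ]; simp
  calc ‖1 - (starRingEnd ℂ) w * ζ‖ = ‖(starRingEnd ℂ) (ζ - w) * ζ‖ := by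
        rw [map_sub, sub_mul, h]
    _ = ‖ζ - w‖ := by rw [norm_mul, hζ, mul_one, RCLike.norm_conj]

lemma norm_ellH_rpow {p : ℝ} (hp : 1 ≤ p) {w : ℂ} (hw : ‖w‖ < 1) (z : ℂ) :
    ‖ellH p w z‖ ^ p = (1 - ‖w‖ ^ 2) / ‖1 - (starRingEnd ℂ) w * z‖ ^ 2 := by
  have h1 : 0 ≤ 1 - ‖w‖ ^ 2 := by nlinarith [norm_nonneg w]
  have hp0 : p ≠ 0 := by linarith
  rw [ellH, norm_div, Complex.norm_cpow_real, Complex.norm_real,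
    Real.norm_of_nonneg (by positivity),
    Real.div_rpow (by positivity) (by positivity), ← Real.rpow_mul h1,
    ← Real.rpow_mul (norm_nonneg _), one_div_mul_cancel hp0, div_mul_cancel₀ _ hp0, Real.rpow_one,
    Real.rpow_two]

lemma differentiableOn_ellH {p : ℝ} {w : ℂ} (hw : ‖w‖ < 1) :
    DifferentiableOn ℂ (ellH p w) (ball (0 : ℂ) 1) := by
  have hs : ∀ z ∈ ball (0 : ℂ) 1, 1 - (starRingEnd ℂ) w * z ∈ Complex.slitPlane := by
    intro z hz
    have hz : ‖z‖ < 1 := by simpa using hz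
    refine Or.inl ?_
    have h1 : ((starRingEnd ℂ) w * z).re < 1 := by
      refine (Complex.re_le_norm _).trans_lt ?_
      rw [norm_mul, RCLike.norm_conj]
      nlinarith [norm_nonneg w, norm_nonneg z]
    simpa using h1
  unfold ellH
  refine DifferentiableOn.div (by fun_prop) (DifferentiableOn.cpow_const (by fun_prop) hs) ?_
  intro z hz
  rw [Ne, Complex.cpow_eq_zero_iff]
  exact fun h => Complex.slitPlane_ne_zero (hs z hz) h.1

lemma circleMean_ellH {p : ℝ} (hp : 1 ≤ p) {w : ℂ} (hw : ‖w‖ < 1) {s : ℝ} (hs0 : 0 ≤ s)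
    (hs : s < 1) : circleMean p (ellH p w) s = (1 - ‖w‖ ^ 2) / (1 - s ^ 2 * ‖w‖ ^ 2) := by
  have hsw := norm_mul_lt_one hs0 hs hw.le
  have h1 : 0 < 1 - s ^ 2 * ‖w‖ ^ 2 := by
    have : s * ‖w‖ < 1 := by simpa [abs_of_nonneg hs0] using hsw
    nlinarith [mul_nonneg hs0 (norm_nonneg w)]
  calc circleMean p (ellH p w) s
      = ∫ ζ, (1 - ‖w‖ ^ 2) / (1 - s ^ 2 * ‖w‖ ^ 2) * discPoisson (s * w) ζ ∂circleM := by
        refine integral_circleM_congr fun ζ hζ => ?_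
        rw [norm_ellH_rpow hp hw, discPoisson, ← norm_one_sub_conj_mul' hζ]
        simp only [norm_mul, Complex.norm_real, Real.norm_eq_abs, mul_pow, sq_abs, map_mul,
          Complex.conj_ofReal]
        rw [div_mul_div_cancel₀ h1.ne', ← mul_assoc, mul_comm (s : ℂ)]
    _ = _ := by rw [integral_const_mul, integral_discPoisson hsw, mul_one]

lemma memHp_ellH {p : ℝ} (hp : 1 ≤ p) {w : ℂ} (hw : ‖w‖ < 1) : MemHp p (ellH p w) := by
  refine memHp_of_circleMean_le (B := 1) hp (differentiableOn_ellH hw) fun s hs0 hs => ?_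
  rw [circleMean_ellH hp hw hs0 hs]
  have h1 : 0 ≤ 1 - ‖w‖ ^ 2 := by nlinarith [norm_nonneg w]
  refine div_le_one_of_le₀ ?_ ?_ <;>
  nlinarith [mul_le_mul_of_nonneg_right (by nlinarith : s ^ 2 ≤ 1) (sq_nonneg ‖w‖)]

lemma one_le_hardyNorm_ellH {p : ℝ} (hp : 1 ≤ p) {w : ℂ} (hw : ‖w‖ < 1) :
    1 ≤ hardyNorm p (ellH p w) := by
  have h1 : 0 < 1 - ‖w‖ ^ 2 := by nlinarith [norm_nonneg w]
  have hlim : Filter.Tendsto (fun s : ℝ => (1 - ‖w‖ ^ 2) / (1 - s ^ 2 * ‖w‖ ^ 2))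
      (nhdsWithin 1 (Set.Iio 1)) (nhds 1) := by
    have : ContinuousAt (fun s : ℝ => (1 - ‖w‖ ^ 2) / (1 - s ^ 2 * ‖w‖ ^ 2)) 1 :=
      ContinuousAt.div (by fun_prop) (by fun_prop) (by simpa using h1.ne')
    have h2 := this.tendsto
    simp only [one_pow, one_mul, div_self h1.ne'] at h2
    exact h2.mono_left nhdsWithin_le_nhds
  have h2 : 1 ≤ hardyNorm p (ellH p w) ^ p := by
    refine le_of_tendsto hlim ?_
    filter_upwards [Ioo_mem_nhdsLT (zero_lt_one' ℝ)] with s hs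
    rw [← circleMean_ellH hp hw hs.1.le hs.2]
    exact circleMean_le_hardyNorm_rpow hp (memHp_ellH hp hw) hs.1.le hs.2
  by_contra! hlt
  exact absurd h2 (not_le.2 (Real.rpow_lt_one hardyNorm_nonneg hlt (by linarith)))

section

variable {r : ℝ} {z : ℂ}

lemma integral_dilated_kernel_le (hr0 : 0 ≤ r) (hr : r < 1) (hz : ‖z‖ ≤ 1) :
    ∫ ω, (1 - r ^ 2) / ‖ω - r * z‖ ^ 2 ∂circleM ≤ 1 := by
  have hrz := norm_mul_lt_one hr0 hr hz
  refine (integral_circleM_mono ?_ ?_ fun ω hω => ?_).trans_eq (integral_discPoisson hrz)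
  · refine ContinuousOn.div (by fun_prop) (by fun_prop) fun ω hω => ?_
    have := sub_ne_zero_of_norm hrz (by simpa using hω)
    positivity
  · exact continuousOn_discPoisson continuousOn_const continuousOn_id (fun _ _ => hrz) (by simp)
  · unfold discPoisson
    refine div_le_div_of_nonneg_right (sub_le_sub_left ?_ 1) (by positivity)
    simp only [norm_mul, Complex.norm_real, Real.norm_eq_abs, mul_pow, sq_abs]
    nlinarith [mul_le_mul_of_nonneg_left (by nlinarith [norm_nonneg z] : ‖z‖ ^ 2 ≤ 1) (sq_nonneg r)]

/-- Poisson-type averages of a continuous function are uniformly close to it from above. -/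
lemma exists_integral_dilated_kernel_le {g : ℂ → ℝ} (hg : ContinuousOn g (closedBall (0 : ℂ) 1))
    (hg0 : ∀ z ∈ closedBall (0 : ℂ) 1, 0 ≤ g z) {ε : ℝ} (hε : 0 < ε) :
    ∃ r : ℝ, 0 ≤ r ∧ r < 1 ∧ ∀ z : ℂ, ‖z‖ < 1 →
      ∫ ω, g ω * ((1 - r ^ 2) / ‖ω - r * z‖ ^ 2) ∂circleM ≤ g z + 2 * ε := by
  obtain ⟨M, hM⟩ := (isCompact_closedBall (0 : ℂ) 1).exists_bound_of_continuousOn hg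
  have hM0 : 0 ≤ M := (norm_nonneg _).trans (hM 0 (by simp))
  obtain ⟨δ, hδ, hδg⟩ := Metric.uniformContinuousOn_iff.1
    ((isCompact_closedBall (0 : ℂ) 1).uniformContinuousOn_of_continuous hg) ε hε
  set t := min (1 / 2) (min (δ / 2) (ε * δ ^ 2 / (8 * (M + 1)))) with ht
  have ht0 : 0 < t := by positivity
  have ht1 : t ≤ 1 / 2 := min_le_left _ _
  have ht2 : t ≤ δ / 2 := (min_le_right _ _).trans (min_le_left _ _)
  have ht3 : t ≤ ε * δ ^ 2 / (8 * (M + 1)) := (min_le_right _ _).trans (min_le_right _ _)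
  rw [le_div_iff₀ (by positivity)] at ht3
  refine ⟨1 - t, by linarith, by linarith, fun z hz => ?_⟩
  set r := 1 - t with hr
  have hr0 : 0 ≤ r := by linarith
  have hr1 : r < 1 := by linarith
  have hrz := norm_mul_lt_one hr0 hr1 hz.le
  have hzm : z ∈ closedBall (0 : ℂ) 1 := by simpa using hz.le
  have hQ : ContinuousOn (fun ω : ℂ => (1 - r ^ 2) / ‖ω - r * z‖ ^ 2) (sphere (0 : ℂ) 1) := by
    refine ContinuousOn.div (by fun_prop) (by fun_prop) fun ω hω => ?_
    have := sub_ne_zero_of_norm hrz (by simpa using hω)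
    positivity
  have hpt : ∀ ω : ℂ, ‖ω‖ = 1 → g ω * ((1 - r ^ 2) / ‖ω - r * z‖ ^ 2) ≤
      (g z + ε) * ((1 - r ^ 2) / ‖ω - r * z‖ ^ 2) + ε := by
    intro ω hω
    have hωm : ω ∈ closedBall (0 : ℂ) 1 := by simp [hω]
    have hd0 : 0 ≤ (1 - r ^ 2) / ‖ω - r * z‖ ^ 2 := div_nonneg (by nlinarith) (by positivity)
    rcases lt_or_ge (dist ω z) δ with hd | hd
    · have := hδg ω hωm z hzm hd
      rw [Real.dist_eq] at this
      have h2 := (abs_lt.1 this).2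
      nlinarith
    · have hfar : δ / 2 ≤ ‖ω - r * z‖ := by
        have h1 : ω - z = (ω - r * z) - t * z := by rw [hr]; push_cast; ring
        have h2 : ‖ω - z‖ ≤ ‖ω - r * z‖ + t * ‖z‖ := by
          rw [h1]
          refine (norm_sub_le _ _).trans_eq ?_
          rw [norm_mul, Complex.norm_real, Real.norm_of_nonneg ht0.le]
        rw [dist_eq_norm] at hd
        nlinarith [norm_nonneg z]
      have hsq : (δ / 2) ^ 2 ≤ ‖ω - r * z‖ ^ 2 := by gcongr
      have hgM : g ω ≤ M := (le_abs_self _).trans (hM ω hωm)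
      have hsmall : M * ((1 - r ^ 2) / ‖ω - r * z‖ ^ 2) ≤ ε := by
        rw [← mul_div_assoc, div_le_iff₀ (lt_of_lt_of_le (by positivity) hsq)]
        have h3 : 1 - r ^ 2 ≤ 2 * t := by rw [hr]; nlinarith
        nlinarith [mul_le_mul_of_nonneg_left h3 hM0, mul_le_mul_of_nonneg_left hsq hε.le]
      have := mul_le_mul_of_nonneg_right hgM hd0
      have := mul_nonneg (add_nonneg (hg0 z hzm) hε.le) hd0
      linarith
  have hInt : ∫ ω, g ω * ((1 - r ^ 2) / ‖ω - r * z‖ ^ 2) ∂circleM ≤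
      ∫ ω, ((g z + ε) * ((1 - r ^ 2) / ‖ω - r * z‖ ^ 2) + ε) ∂circleM :=
    integral_circleM_mono ((hg.mono sphere_subset_closedBall).mul hQ)
    ((continuousOn_const.mul hQ).add continuousOn_const) hpt
  rw [integral_add (f := fun ω : ℂ => (g z + ε) * ((1 - r ^ 2) / ‖ω - r * z‖ ^ 2))
    (integrable_circleM (continuousOn_const.mul hQ))
    (integrable_circleM continuousOn_const), integral_const_mul] at hInt
  have h1 := mul_le_mul_of_nonneg_left (integral_dilated_kernel_le hr0 hr1 hz.le)
    (add_nonneg (hg0 z hzm) hε.le)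
  simp only [integral_const, probReal_univ, smul_eq_mul, one_mul] at hInt
  linarith

end

lemma circleMean_mul_ellH {p : ℝ} (hp : 1 ≤ p) {h ψ : ℂ → ℂ} {r : ℝ} (hr0 : 0 ≤ r) (hr : r < 1)
    {ω : ℂ} (hω : ‖ω‖ = 1) (s : ℝ) :
    circleMean p (fun z => h z * ellH p (r * ω) (ψ z)) s =
      ∫ ζ, ‖h (s * ζ)‖ ^ p * ((1 - r ^ 2) / ‖ω - r * ψ (s * ζ)‖ ^ 2) ∂circleM := by
  refine integral_congr_ae (ae_of_all _ fun ζ => ?_)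
  simp only
  rw [norm_mul, Real.mul_rpow (norm_nonneg _) (norm_nonneg _),
    norm_ellH_rpow hp (norm_mul_lt_one hr0 hr hω.le), norm_one_sub_conj_mul hω]
  simp [hω, abs_of_nonneg hr0]

/-- Lower bounds on the kernels `ellH` imply a reverse Carleson inequality for continuous
functions on the closed disc. -/
lemma reverse_carleson {p : ℝ} (hp : 1 ≤ p) {h ψ : ℂ → ℂ} (hh : MemHp p h)
    (hψd : DifferentiableOn ℂ ψ (ball (0 : ℂ) 1))
    (hψm : Set.MapsTo ψ (ball (0 : ℂ) 1) (ball (0 : ℂ) 1)) {C : ℝ} (hC : 0 < C)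
    (hker : ∀ w ∈ ball (0 : ℂ) 1, C ≤ hardyNorm p (fun z => h z * ellH p w (ψ z)))
    {g : ℂ → ℝ} (hg : ContinuousOn g (closedBall (0 : ℂ) 1))
    (hg0 : ∀ z ∈ closedBall (0 : ℂ) 1, 0 ≤ g z) {B : ℝ}
    (hB : ∀ s : ℝ, 0 ≤ s → s < 1 → ∫ ζ, ‖h (s * ζ)‖ ^ p * g (ψ (s * ζ)) ∂circleM ≤ B) :
    C ^ p * ∫ ζ, g ζ ∂circleM ≤ B := by
  set A := hardyNorm p h ^ p with hA
  have hA0 : 0 ≤ A := Real.rpow_nonneg hardyNorm_nonneg _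
  suffices H : ∀ ε > 0, C ^ p * ∫ ζ, g ζ ∂circleM ≤ B + 2 * ε * A by
    refine le_of_forall_pos_le_add fun ε hε => (H (ε / (2 * (A + 1))) (by positivity)).trans ?_
    have : 2 * (ε / (2 * (A + 1))) * A = ε * (A / (A + 1)) := by field_simp
    rw [this]
    have : A / (A + 1) ≤ 1 := div_le_one_of_le₀ (by linarith) (by positivity)
    nlinarith
  intro ε hε
  obtain ⟨r, hr0, hr, hgr⟩ := exists_integral_dilated_kernel_le hg hg0 hε
  have hgS := hg.mono (sphere_subset_closedBall (x := (0 : ℂ)) (ε := 1))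
  set J : ℝ → ℂ → ℝ := fun s ω => circleMean p (fun z => h z * ellH p (r * ω) (ψ z)) s with hJ
  have hJ0 : ∀ s ω, 0 ≤ J s ω := fun s ω => circleMean_nonneg
  have hψs : ∀ s : ℝ, 0 ≤ s → s < 1 →
      ContinuousOn (fun ζ : ℂ => ψ (s * ζ)) (sphere (0 : ℂ) 1) := fun s hs0 hs =>
    (continuousOn_dilate hψd hs0 hs).mono sphere_subset_closedBall
  have hψn : ∀ s : ℝ, 0 ≤ s → s < 1 → ∀ ζ : ℂ, ‖ζ‖ = 1 → ‖ψ (s * ζ)‖ < 1 :=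
    fun s hs0 hs ζ hζ => by
      simpa using hψm (show (s : ℂ) * ζ ∈ ball (0 : ℂ) 1 by
        simpa using norm_mul_lt_one hs0 hs hζ.le)
  have hprod : ∀ s : ℝ, 0 ≤ s → s < 1 → Integrable (fun q : ℂ × ℂ =>
      g q.1 * (‖h (s * q.2)‖ ^ p * ((1 - r ^ 2) / ‖q.1 - r * ψ (s * q.2)‖ ^ 2)))
      (circleM.prod circleM) := by
    intro s hs0 hs
    refine integrable_circleM_prod (ContinuousOn.mul (hgS.comp continuousOn_fst fun x hx => hx.1)
      (ContinuousOn.mul ((continuousOn_norm_rpow_dilate hp hh.1 hs0 hs).comp continuousOn_snd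
        fun x hx => hx.2) (ContinuousOn.div continuousOn_const ?_ fun x hx => ?_)))
    · have h1 : ContinuousOn (fun q : ℂ × ℂ => ψ (s * q.2))
          (sphere (0 : ℂ) 1 ×ˢ sphere (0 : ℂ) 1) :=
        (hψs s hs0 hs).comp continuousOn_snd fun x hx => hx.2
      exact (continuousOn_fst.sub (continuousOn_const.mul h1)).norm.pow 2
    · have := sub_ne_zero_of_norm (norm_mul_lt_one hr0 hr
        (hψn s hs0 hs x.2 (by simpa using hx.2)).le) (by simpa using hx.1 : ‖x.1‖ = 1)
      positivity
  have hgJ : ∀ s : ℝ, (fun ω => ∫ ζ, g ω * (‖h (s * ζ)‖ ^ p *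
      ((1 - r ^ 2) / ‖ω - r * ψ (s * ζ)‖ ^ 2)) ∂circleM) =ᵐ[circleM] fun ω => g ω * J s ω := by
    intro s
    refine ae_circleM_of_forall fun ω hω => ?_
    simp only [hJ]
    rw [circleMean_mul_ellH hp hr0 hr hω, integral_const_mul]
  have hgJi : ∀ s : ℝ, 0 ≤ s → s < 1 → Integrable (fun ω => g ω * J s ω) circleM :=
    fun s hs0 hs => (hprod s hs0 hs).integral_prod_left.congr (hgJ s)
  have hup : ∀ s : ℝ, 0 ≤ s → s < 1 → ∫ ω, g ω * J s ω ∂circleM ≤ B + 2 * ε * A := by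
    intro s hs0 hs
    have hhs := continuousOn_norm_rpow_dilate hp hh.1 hs0 hs
    have hgψ : ContinuousOn (fun ζ : ℂ => g (ψ (s * ζ))) (sphere (0 : ℂ) 1) :=
      hg.comp (hψs s hs0 hs) fun ζ hζ => by
        simpa using (hψn s hs0 hs ζ (by simpa using hζ)).le
    have i1 : Integrable (fun ζ => ‖h (s * ζ)‖ ^ p * g (ψ (s * ζ))) circleM :=
      integrable_circleM (hhs.mul hgψ)
    have i2 : Integrable (fun ζ => 2 * ε * ‖h (s * ζ)‖ ^ p) circleM :=
      integrable_circleM (continuousOn_const.mul hhs)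
    calc ∫ ω, g ω * J s ω ∂circleM
        = ∫ ζ, ∫ ω, g ω * (‖h (s * ζ)‖ ^ p *
            ((1 - r ^ 2) / ‖ω - r * ψ (s * ζ)‖ ^ 2)) ∂circleM ∂circleM := by
          rw [← integral_congr_ae (hgJ s)]
          exact integral_integral_swap (hprod s hs0 hs)
      _ ≤ ∫ ζ, (‖h (s * ζ)‖ ^ p * g (ψ (s * ζ)) + 2 * ε * ‖h (s * ζ)‖ ^ p) ∂circleM := by
          refine integral_mono_ae (hprod s hs0 hs).integral_prod_right (i1.add i2)
            (ae_circleM_of_forall fun ζ hζ => ?_)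
          have h1 := mul_le_mul_of_nonneg_left (hgr _ (hψn s hs0 hs ζ hζ))
            (Real.rpow_nonneg (norm_nonneg (h (s * ζ))) p)
          rw [← integral_const_mul] at h1
          simp only [mul_left_comm (g _)]
          linarith
      _ ≤ B + 2 * ε * A := by
          rw [integral_add i1 i2, integral_const_mul]
          exact add_le_add (hB s hs0 hs) (mul_le_mul_of_nonneg_left
            (circleMean_le_hardyNorm_rpow hp hh hs0 hs) (by positivity))
  set u : ℕ → ℝ := fun n => 1 - 1 / ((n : ℝ) + 1) with hu
  have hu0 : ∀ n, 0 ≤ u n := fun n => by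
    have : 1 / ((n : ℝ) + 1) ≤ 1 := div_le_one_of_le₀ (by simp) (by positivity)
    simp only [hu]; linarith
  have hu1 : ∀ n, u n < 1 := fun n => by
    have : 0 < 1 / ((n : ℝ) + 1) := by positivity
    simp only [hu]; linarith
  have hulim : Filter.Tendsto u Filter.atTop (nhds 1) := by
    simpa [hu] using tendsto_one_div_add_atTop_nhds_zero_nat.const_sub (1 : ℝ)
  have hCp : 0 < C ^ p := Real.rpow_pos_of_pos hC p
  have hmin : ∀ n ω, g ω * min (J (u n) ω) (C ^ p) = min (g ω * J (u n) ω) (g ω * C ^ p) ∨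
      ¬ ‖ω‖ = 1 := fun n ω => by
    by_cases hω : ‖ω‖ = 1
    · exact Or.inl (mul_min_of_nonneg _ _ (hg0 ω (by simp [hω])))
    · exact Or.inr hω
  have hgC : Integrable (fun ω => g ω * C ^ p) circleM :=
    integrable_circleM (hgS.mul continuousOn_const)
  have hmin_int : ∀ n, Integrable (fun ω => g ω * min (J (u n) ω) (C ^ p)) circleM := fun n =>
    ((hgJi (u n) (hu0 n) (hu1 n)).inf hgC).congr
      (ae_circleM_of_forall fun ω hω => ((hmin n ω).resolve_right (not_not.2 hω)).symm)
  have hlim : Filter.Tendsto (fun n => ∫ ω, g ω * min (J (u n) ω) (C ^ p) ∂circleM) Filter.atTop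
      (nhds (∫ ω, g ω * C ^ p ∂circleM)) := by
    refine tendsto_integral_of_dominated_convergence (fun ω => g ω * C ^ p)
      (fun n => (hmin_int n).aestronglyMeasurable) hgC
      (fun n => ae_circleM_of_forall fun ω hω => ?_) (ae_circleM_of_forall fun ω hω => ?_)
    · have hgω := hg0 ω (by simp [hω])
      rw [Real.norm_of_nonneg (mul_nonneg hgω (le_min (hJ0 _ _) hCp.le))]
      exact mul_le_mul_of_nonneg_left (min_le_right _ _) hgω
    · refine Filter.Tendsto.const_mul _ ?_
      refine tendsto_order.2 ⟨fun c hc => ?_, fun c hc =>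
        Filter.Eventually.of_forall fun n => (min_le_right _ _).trans_lt hc⟩
      have hω' := norm_mul_lt_one hr0 hr hω.le
      obtain ⟨s, hs0, hs, hcs⟩ := exists_lt_circleMean hp hC
        (hker (r * ω) (by simpa using hω')) hc
      filter_upwards [hulim.eventually (lt_mem_nhds hs)] with n hn
      refine lt_min (hcs.trans_le (circleMean_mono hp ?_ hs0 hn.le (hu1 n))) hc
      exact hh.1.mul ((differentiableOn_ellH hω').comp hψd hψm)
  have hfin := le_of_tendsto' hlim fun n => (integral_mono_ae (hmin_int n)
    (hgJi (u n) (hu0 n) (hu1 n)) (ae_circleM_of_forall fun ω hω =>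
      mul_le_mul_of_nonneg_left (min_le_left _ _) (hg0 ω (by simp [hω])))).trans
    (hup (u n) (hu0 n) (hu1 n))
  rw [integral_mul_const] at hfin
  linarith

lemma integral_pow_circleM (k : ℕ) : ∫ ζ, ζ ^ k ∂circleM = if k = 0 then 1 else 0 := by
  have hd : DiffContOnCl ℂ (fun z : ℂ => z ^ k) (ball (0 : ℂ) |1|) :=
    (differentiable_pow k).diffContOnCl
  rw [integral_circleM_eq_circleAverage (by fun_prop), hd.circleAverage]
  simp [zero_pow_eq]

lemma integral_pow_mul_conj_pow_circleM (m n : ℕ) :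
    ∫ ζ, ζ ^ m * (starRingEnd ℂ) (ζ ^ n) ∂circleM = if m = n then 1 else 0 := by
  have hu : ∀ ζ : ℂ, ‖ζ‖ = 1 → ∀ k : ℕ, ζ ^ k * (starRingEnd ℂ) (ζ ^ k) = 1 := fun ζ hζ k => by
    rw [Complex.mul_conj, Complex.normSq_eq_norm_sq, norm_pow, hζ]; simp
  rcases le_total n m with hnm | hnm
  · obtain ⟨k, rfl⟩ := Nat.exists_eq_add_of_le hnm
    rw [integral_circleM_congr (g := fun ζ => ζ ^ k), integral_pow_circleM]
    · simp
    · intro ζ hζ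
      rw [pow_add, mul_right_comm, hu ζ hζ, one_mul]
  · obtain ⟨k, rfl⟩ := Nat.exists_eq_add_of_le hnm
    rw [integral_circleM_congr (g := fun ζ => (starRingEnd ℂ) (ζ ^ k)), integral_conj,
      integral_pow_circleM]
    · by_cases hk : k = 0 <;> simp [hk]
    · intro ζ hζ
      rw [pow_add, map_mul, ← mul_assoc, hu ζ hζ, one_mul]

section

variable {G : ℂ → ℂ} {a : ℕ → ℂ}

lemma summable_norm_mul_pow (hG : ∀ z : ℂ, ‖z‖ < 1 → HasSum (fun n => a n * z ^ n) (G z)) {s : ℝ}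
    (hs0 : 0 ≤ s) (hs : s < 1) : Summable fun n => ‖a n‖ * s ^ n := by
  have := (hG s (by simpa [abs_of_nonneg hs0] using hs)).summable.norm
  simpa [abs_of_nonneg hs0] using this

lemma hasSum_integral_dilate_mul
    (hG : ∀ z : ℂ, ‖z‖ < 1 → HasSum (fun n => a n * z ^ n) (G z)) {s : ℝ} (hs0 : 0 ≤ s)
    (hs : s < 1) {φ : ℂ → ℂ} (hφ : ContinuousOn φ (sphere (0 : ℂ) 1)) :
    HasSum (fun n => a n * s ^ n * ∫ ζ, ζ ^ n * φ ζ ∂circleM)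
      (∫ ζ, G (s * ζ) * φ ζ ∂circleM) := by
  have hsum := summable_norm_mul_pow hG hs0 hs
  have hφi := integrable_circleM hφ
  have key := hasSum_integral_of_dominated_convergence (μ := circleM)
    (F := fun n ζ => a n * s ^ n * (ζ ^ n * φ ζ)) (f := fun ζ => G (s * ζ) * φ ζ)
    (fun n ζ => ‖a n‖ * s ^ n * ‖φ ζ‖)
    (fun n => (integrable_circleM (continuousOn_const.mul ((by fun_prop :
      ContinuousOn (fun ζ : ℂ => ζ ^ n) _).mul hφ))).aestronglyMeasurable)
    (fun n => ae_circleM_of_forall fun ζ hζ => by simp [hζ, abs_of_nonneg hs0])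
    (ae_of_all _ fun ζ => hsum.mul_right _)
    (by simp only [tsum_mul_right]; exact hφi.norm.const_mul _)
    (ae_circleM_of_forall fun ζ hζ => by
      have := (hG (s * ζ) (norm_mul_lt_one hs0 hs hζ.le)).mul_right (φ ζ)
      refine this.congr_fun ?_ |> id
      intro n
      ring)
  simpa only [integral_const_mul] using key

/-- Parseval's identity on the circle of radius `s`. -/
lemma hasSum_circleMean_two (hGd : DifferentiableOn ℂ G (ball (0 : ℂ) 1))
    (hG : ∀ z : ℂ, ‖z‖ < 1 → HasSum (fun n => a n * z ^ n) (G z)) {s : ℝ} (hs0 : 0 ≤ s)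
    (hs : s < 1) : HasSum (fun n => ‖a n‖ ^ 2 * (s ^ n) ^ 2) (circleMean 2 G s) := by
  have hc : ContinuousOn (fun ζ : ℂ => G (s * ζ)) (sphere (0 : ℂ) 1) :=
    (continuousOn_dilate hGd hs0 hs).mono sphere_subset_closedBall
  have hconj : ∀ φ : ℂ → ℂ, ContinuousOn φ (sphere (0 : ℂ) 1) →
      ContinuousOn (fun ζ => (starRingEnd ℂ) (φ ζ)) (sphere (0 : ℂ) 1) := fun φ hφ =>
    Complex.continuous_conj.comp_continuousOn hφ
  have hcoef : ∀ n : ℕ, ∫ ζ, G (s * ζ) * (starRingEnd ℂ) (ζ ^ n) ∂circleM = a n * s ^ n := by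
    intro n
    refine (hasSum_integral_dilate_mul hG hs0 hs (hconj (fun ζ => ζ ^ n) (by fun_prop))).unique ?_
    simp only [integral_pow_mul_conj_pow_circleM, mul_ite, mul_one, mul_zero]
    exact hasSum_ite_eq n (a n * (s : ℂ) ^ n) |> fun h => by
      convert! h using 2 with m
      split_ifs with h1
      · rw [h1]
      · rfl
  have h := hasSum_integral_dilate_mul hG hs0 hs (hconj _ hc)
  have hterm : ∀ n : ℕ, a n * s ^ n * ∫ ζ, ζ ^ n * (starRingEnd ℂ) (G (s * ζ)) ∂circleM =
      ((‖a n‖ ^ 2 * (s ^ n) ^ 2 : ℝ) : ℂ) := by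
    intro n
    have h1 : ∫ ζ, ζ ^ n * (starRingEnd ℂ) (G (s * ζ)) ∂circleM =
        (starRingEnd ℂ) (a n * s ^ n) := by
      rw [← hcoef n, ← integral_conj]
      refine integral_congr_ae (ae_of_all _ fun ζ => ?_)
      simp [mul_comm]
    rw [h1, Complex.mul_conj, Complex.normSq_eq_norm_sq, norm_mul, norm_pow, Complex.norm_real,
      Real.norm_of_nonneg hs0, mul_pow]
  have hval : ∫ ζ, G (s * ζ) * (starRingEnd ℂ) (G (s * ζ)) ∂circleM =
      ((circleMean 2 G s : ℝ) : ℂ) := by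
    rw [circleMean, ← integral_complex_ofReal]
    refine integral_congr_ae (ae_of_all _ fun ζ => ?_)
    simp only [Complex.mul_conj, Complex.normSq_eq_norm_sq, Real.rpow_two]
  simp only [hterm, hval] at h
  exact_mod_cast h

lemma exists_hasSum_pow (hGd : DifferentiableOn ℂ G (ball (0 : ℂ) 1)) :
    ∃ a : ℕ → ℂ, ∀ z : ℂ, ‖z‖ < 1 → HasSum (fun n => a n * z ^ n) (G z) := by
  refine ⟨fun n => (n.factorial : ℂ)⁻¹ * iteratedDeriv n G 0, fun z hz => ?_⟩
  have := Complex.hasSum_taylorSeries_on_ball (c := 0) (r := 1) (f := G) hGd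
    (show z ∈ ball (0 : ℂ) 1 by simpa using hz)
  simp only [sub_zero, smul_eq_mul] at this
  convert! this using 2 with n
  ring

lemma tendsto_circleMean_two_sub_dilate {N : ℝ} (hGd : DifferentiableOn ℂ G (ball (0 : ℂ) 1))
    (hN : ∀ z : ℂ, ‖z‖ < 1 → ‖G z‖ ≤ N) {ε : ℝ} (hε : 0 < ε) :
    ∀ᶠ ρ : ℝ in nhdsWithin 1 (Set.Iio 1), ∀ s : ℝ, 0 ≤ s → s < 1 →
      circleMean 2 (fun z => G z - G (ρ * z)) s ≤ ε := by
  obtain ⟨a, ha⟩ := exists_hasSum_pow hGd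
  have hIoo := Ioo_mem_nhdsLT (zero_lt_one' ℝ)
  have hsq : Summable fun n => ‖a n‖ ^ 2 := by
    refine summable_of_sum_le (c := N ^ 2) (fun _ => by positivity) fun u => ?_
    have hlim : Filter.Tendsto (fun s : ℝ => ∑ n ∈ u, ‖a n‖ ^ 2 * (s ^ n) ^ 2)
        (nhdsWithin 1 (Set.Iio 1)) (nhds (∑ n ∈ u, ‖a n‖ ^ 2)) := by
      have : Continuous fun s : ℝ => ∑ n ∈ u, ‖a n‖ ^ 2 * (s ^ n) ^ 2 := by fun_prop
      simpa using (this.tendsto 1).mono_left nhdsWithin_le_nhds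
    refine le_of_tendsto hlim ?_
    filter_upwards [hIoo] with s hs
    refine (sum_le_hasSum u (fun _ _ => by positivity)
      (hasSum_circleMean_two hGd ha hs.1.le hs.2)).trans ?_
    refine circleMean_le_of_bound (by norm_num) hGd hs.1.le hs.2 fun ζ hζ => ?_
    rw [Real.rpow_two]
    have := hN _ (norm_mul_lt_one hs.1.le hs.2 hζ.le)
    gcongr
  have hlim : Filter.Tendsto (fun ρ : ℝ => ∑' n, ‖a n‖ ^ 2 * (1 - ρ ^ n) ^ 2)
      (nhdsWithin 1 (Set.Iio 1)) (nhds 0) := by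
    have := tendsto_tsum_of_dominated_convergence (𝓕 := nhdsWithin (1 : ℝ) (Set.Iio 1))
      (f := fun ρ n => ‖a n‖ ^ 2 * (1 - ρ ^ n) ^ 2) (g := fun _ => (0 : ℝ)) hsq
      (fun n => by
        have : Continuous fun ρ : ℝ => ‖a n‖ ^ 2 * (1 - ρ ^ n) ^ 2 := by fun_prop
        simpa using (this.tendsto 1).mono_left nhdsWithin_le_nhds)
      (by
        filter_upwards [hIoo] with ρ hρ n
        have h1 := pow_le_one₀ (n := n) hρ.1.le hρ.2.le
        have h2 := pow_nonneg hρ.1.le n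
        rw [Real.norm_of_nonneg (by positivity)]
        exact mul_le_of_le_one_right (by positivity) (by nlinarith))
    simpa using this
  filter_upwards [hIoo, hlim.eventually (gt_mem_nhds hε)] with ρ hρ hρε s hs0 hs
  have hρz : ∀ z : ℂ, ‖z‖ < 1 → ‖(ρ : ℂ) * z‖ < 1 := fun z hz =>
    norm_mul_lt_one hρ.1.le hρ.2 hz.le
  have hD : ∀ z : ℂ, ‖z‖ < 1 →
      HasSum (fun n => a n * (1 - ρ ^ n) * z ^ n) (G z - G (ρ * z)) := fun z hz => by
    convert! (ha z hz).sub (ha (ρ * z) (hρz z hz)) using 2 with n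
    ring
  have hDd : DifferentiableOn ℂ (fun z => G z - G (ρ * z)) (ball (0 : ℂ) 1) :=
    hGd.sub (diffContOnCl_dilate hGd hρ.1.le hρ.2).1
  have hsum := hasSum_circleMean_two hDd hD hs0 hs
  have hb : ∀ n : ℕ, ‖a n‖ ^ 2 * (1 - ρ ^ n) ^ 2 ≤ ‖a n‖ ^ 2 := fun n => by
    have h1 := pow_le_one₀ (n := n) hρ.1.le hρ.2.le
    have h2 := pow_nonneg hρ.1.le n
    exact mul_le_of_le_one_right (by positivity) (by nlinarith)
  refine le_trans (hasSum_le (fun n => ?_) hsum (Summable.of_nonneg_of_le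
    (fun n => by positivity) hb hsq).hasSum) hρε.le
  have h3 : ‖a n * (1 - (ρ : ℂ) ^ n)‖ ^ 2 = ‖a n‖ ^ 2 * (1 - ρ ^ n) ^ 2 := by
    rw [norm_mul, mul_pow, ← Complex.ofReal_pow, ← Complex.ofReal_one, ← Complex.ofReal_sub,
      Complex.norm_real, Real.norm_eq_abs, sq_abs]
  rw [h3]
  exact mul_le_of_le_one_right (by positivity)
    (pow_le_one₀ (by positivity) (pow_le_one₀ hs0 hs.le))

lemma tendsto_circleMean_sub_dilate {p N : ℝ} (hp : 1 ≤ p)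
    (hGd : DifferentiableOn ℂ G (ball (0 : ℂ) 1))
    (hN : ∀ z : ℂ, ‖z‖ < 1 → ‖G z‖ ≤ N) {ε : ℝ} (hε : 0 < ε) :
    ∀ᶠ ρ : ℝ in nhdsWithin 1 (Set.Iio 1), ∀ s : ℝ, 0 ≤ s → s < 1 →
      circleMean p (fun z => G z - G (ρ * z)) s ≤ ε := by
  have hN0 : 0 ≤ N := (norm_nonneg _).trans (hN 0 (by simp))
  set η := min 1 (ε / 2) with hη
  have hη0 : 0 < η := by positivity
  set K := (2 * N) ^ p / η ^ 2 with hK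
  have hK0 : 0 ≤ K := by positivity
  have hpt : ∀ x : ℝ, 0 ≤ x → x ≤ 2 * N → x ^ p ≤ ε / 2 + K * x ^ (2 : ℝ) := by
    intro x hx0 hx
    have hKx : 0 ≤ K * x ^ (2 : ℝ) := by positivity
    rcases le_total x η with hxη | hxη
    · have h1 := Real.rpow_le_rpow_of_exponent_ge' hx0 (hxη.trans (min_le_left _ _))
        zero_le_one hp
      rw [Real.rpow_one] at h1
      have := hxη.trans (min_le_right _ _)
      linarith
    · have h1 : x ^ p ≤ (2 * N) ^ p := Real.rpow_le_rpow hx0 hx (by linarith)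
      have h2 : (2 * N) ^ p ≤ K * x ^ (2 : ℝ) := by
        rw [hK, Real.rpow_two, div_mul_eq_mul_div, le_div_iff₀ (by positivity)]
        exact mul_le_mul_of_nonneg_left (by gcongr) (by positivity)
      linarith
  filter_upwards [Ioo_mem_nhdsLT (zero_lt_one' ℝ),
    tendsto_circleMean_two_sub_dilate hGd hN (ε := ε / (2 * (K + 1))) (by positivity)]
    with ρ hρ hρ2 s hs0 hs
  have hDd : DifferentiableOn ℂ (fun z => G z - G (ρ * z)) (ball (0 : ℂ) 1) :=
    hGd.sub (diffContOnCl_dilate hGd hρ.1.le hρ.2).1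
  have c1 := continuousOn_norm_rpow_dilate hp hDd hs0 hs
  have c2 := continuousOn_norm_rpow_dilate one_le_two hDd hs0 hs
  have h1 : circleMean p (fun z => G z - G (ρ * z)) s ≤
      ∫ ζ, (ε / 2 + K * ‖G (s * ζ) - G (ρ * (s * ζ))‖ ^ (2 : ℝ)) ∂circleM := by
    refine integral_circleM_mono c1 (continuousOn_const.add (continuousOn_const.mul c2))
      fun ζ hζ => hpt _ (norm_nonneg _) ?_
    have hz := norm_mul_lt_one hs0 hs hζ.le
    refine (norm_sub_le _ _).trans ?_
    have := hN _ hz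
    have := hN _ (norm_mul_lt_one hρ.1.le hρ.2 hz.le)
    linarith
  rw [integral_add (integrable_const _) ((integrable_circleM c2).const_mul K),
    integral_const_mul] at h1
  have h2 := mul_le_mul_of_nonneg_left (hρ2 s hs0 hs) hK0
  have h3 : K * (ε / (2 * (K + 1))) ≤ ε / 2 := by
    rw [← mul_div_assoc, div_le_div_iff₀ (by positivity) (by positivity)]
    nlinarith
  simp only [integral_const, probReal_univ, smul_eq_mul, one_mul] at h1
  simp only [circleMean] at h1 h2 ⊢
  linarith

end

lemma add_rpow_le_two_rpow_mul {a b p : ℝ} (ha : 0 ≤ a) (hb : 0 ≤ b) (hp : 0 ≤ p) :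
    (a + b) ^ p ≤ 2 ^ p * (a ^ p + b ^ p) := by
  have ha' := Real.rpow_nonneg ha p
  have hb' := Real.rpow_nonneg hb p
  have hmax : (a + b) ^ p ≤ 2 ^ p * max a b ^ p := by
    rw [← Real.mul_rpow zero_le_two (le_max_of_le_left ha)]
    exact Real.rpow_le_rpow (by positivity)
      (by linarith [le_max_left a b, le_max_right a b]) hp
  refine hmax.trans (mul_le_mul_of_nonneg_left ?_ (by positivity))
  rcases max_choice a b with h | h <;> rw [h] <;> linarith

lemma mul_hardyNorm_le_of_bounded {p : ℝ} (hp : 1 ≤ p) {h ψ : ℂ → ℂ} (hh : MemHp p h)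
    (hψd : DifferentiableOn ℂ ψ (ball (0 : ℂ) 1))
    (hψm : Set.MapsTo ψ (ball (0 : ℂ) 1) (ball (0 : ℂ) 1))
    {M : ℝ} (hM : 0 < M)
    (hbdd : ∀ f : ℂ → ℂ, MemHp p f → MemHp p (fun z => h z * f (ψ z)) ∧
      hardyNorm p (fun z => h z * f (ψ z)) ≤ M * hardyNorm p f) {C : ℝ} (hC : 0 < C)
    (hker : ∀ w ∈ ball (0 : ℂ) 1, C ≤ hardyNorm p (fun z => h z * ellH p w (ψ z)))
    {F : ℂ → ℂ} (hF : DifferentiableOn ℂ F (ball (0 : ℂ) 1)) {N : ℝ}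
    (hN : ∀ z : ℂ, ‖z‖ < 1 → ‖F z‖ ≤ N) :
    C / 2 * hardyNorm p F ≤ hardyNorm p (fun z => h z * F (ψ z)) := by
  have hp0 : 0 < p := by linarith
  set T := hardyNorm p (fun z => h z * F (ψ z)) with hT
  have hT0 : 0 ≤ T := hardyNorm_nonneg
  have hFH := memHp_of_bounded hp hF hN
  have key : ∀ s₀ : ℝ, 0 ≤ s₀ → s₀ < 1 → C ^ p * circleMean p F s₀ ≤ 2 ^ p * T ^ p := by
    intro s₀ hs₀ hs₀1
    refine le_of_forall_pos_le_add fun ε hε => ?_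
    set ε' := ε / (2 ^ p * M ^ p) with hε'
    have hε'0 : 0 < ε' := by positivity
    obtain ⟨ρ, ⟨hρs, hρ⟩, hρε⟩ := ((Filter.eventually_of_mem (Ioo_mem_nhdsLT hs₀1)
      fun _ hx => hx).and (tendsto_circleMean_sub_dilate hp hF hN hε'0)).exists
    have hρ0 := hs₀.trans hρs.le
    have hρd : DifferentiableOn ℂ (fun z => F (ρ * z)) (ball (0 : ℂ) 1) :=
      (diffContOnCl_dilate hF hρ0 hρ).1
    have hρH : MemHp p fun z => F (ρ * z) := memHp_of_bounded hp hρd fun z hz =>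
      hN _ (norm_mul_lt_one hρ0 hρ hz.le)
    have hDH : MemHp p fun z => F z - F (ρ * z) :=
      memHp_of_circleMean_le hp (hF.sub hρd) hρε
    have hDn : hardyNorm p (fun z => F z - F (ρ * z)) ≤ ε' ^ (1 / p) :=
      hardyNorm_le_of_circleMean_le hp (by positivity) fun s hs0 hs => by
        rw [← Real.rpow_mul hε'0.le, one_div, inv_mul_cancel₀ hp0.ne', Real.rpow_one]
        exact hρε s hs0 hs
    obtain ⟨hWD, hWDn⟩ := hbdd _ hDH
    have hWDn' := hWDn.trans (mul_le_mul_of_nonneg_left hDn hM.le)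
    have hWDm : ∀ s : ℝ, 0 ≤ s → s < 1 →
        circleMean p (fun z => h z * (F (ψ z) - F (ρ * ψ z))) s ≤ M ^ p * ε' := by
      intro s hs0 hs
      refine (circleMean_le_hardyNorm_rpow hp hWD hs0 hs).trans ?_
      refine (Real.rpow_le_rpow hardyNorm_nonneg hWDn' hp0.le).trans_eq ?_
      rw [Real.mul_rpow hM.le (by positivity), ← Real.rpow_mul hε'0.le, one_div,
        inv_mul_cancel₀ hp0.ne', Real.rpow_one]
    have hrev := reverse_carleson hp hh hψd hψm hC hker (g := fun z => ‖F (ρ * z)‖ ^ p)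
      ((continuousOn_dilate hF hρ0 hρ).norm.rpow_const fun _ _ => Or.inr hp0.le)
      (fun _ _ => by positivity) (B := 2 ^ p * (T ^ p + M ^ p * ε')) fun s hs0 hs => by
        have c1 := continuousOn_norm_rpow_dilate hp (hbdd _ hFH).1.1 hs0 hs
        have c2 := continuousOn_norm_rpow_dilate hp hWD.1 hs0 hs
        have c3 := continuousOn_norm_rpow_dilate hp (hbdd _ hρH).1.1 hs0 hs
        simp only [← Real.mul_rpow (norm_nonneg _) (norm_nonneg _), ← norm_mul]
        refine (integral_circleM_mono c3 (continuousOn_const.mul (c1.add c2))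
          (g := fun ζ => 2 ^ p * (‖h (s * ζ) * F (ψ (s * ζ))‖ ^ p +
            ‖h (s * ζ) * (F (ψ (s * ζ)) - F (ρ * ψ (s * ζ)))‖ ^ p)) fun ζ hζ => ?_).trans ?_
        · refine le_trans (Real.rpow_le_rpow (norm_nonneg _) ?_ hp0.le)
            (add_rpow_le_two_rpow_mul (norm_nonneg _) (norm_nonneg _) hp0.le)
          refine le_trans (le_of_eq ?_) (norm_sub_le _ _)
          congr 1
          ring
        · rw [integral_const_mul, integral_add (integrable_circleM c1) (integrable_circleM c2)]
          refine mul_le_mul_of_nonneg_left (add_le_add ?_ (hWDm s hs0 hs)) (by positivity)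
          exact circleMean_le_hardyNorm_rpow hp (hbdd _ hFH).1 hs0 hs
    refine (mul_le_mul_of_nonneg_left (circleMean_mono hp hF hs₀ hρs.le hρ)
      (by positivity)).trans (hrev.trans_eq ?_)
    rw [hε']
    field_simp
  have h2 : hardyNorm p F ≤ 2 / C * T := by
    refine hardyNorm_le_of_circleMean_le hp (by positivity) fun s hs0 hs => ?_
    rw [Real.mul_rpow (by positivity) hT0, Real.div_rpow zero_le_two hC.le, div_mul_eq_mul_div,
      le_div_iff₀ (by positivity), mul_comm]
    exact key s hs0 hs
  calc C / 2 * hardyNorm p F ≤ C / 2 * (2 / C * T) := by gcongr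
    _ = T := by field_simp

lemma norm_moment_le {φ : ℂ → ℝ} (n : ℕ) :
    ‖∫ ζ, (starRingEnd ℂ) ζ ^ n * φ ζ ∂circleM‖ ≤ ∫ ζ, ‖φ ζ‖ ∂circleM := by
  refine (norm_integral_le_integral_norm _).trans_eq
    (integral_congr_ae (ae_circleM_of_forall fun ζ hζ => ?_))
  simp [hζ]

lemma hasSum_moment_mul_pow {φ : ℂ → ℝ} (hφ : ContinuousOn φ (sphere (0 : ℂ) 1)) {z : ℂ}
    (hz : ‖z‖ < 1) :
    HasSum (fun n : ℕ => (∫ ζ, (starRingEnd ℂ) ζ ^ n * φ ζ ∂circleM) * z ^ n)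
      (∫ ζ, (1 - (starRingEnd ℂ) ζ * z)⁻¹ * φ ζ ∂circleM) := by
  have hφ' : ContinuousOn (fun ζ => (φ ζ : ℂ)) (sphere (0 : ℂ) 1) :=
    Complex.continuous_ofReal.comp_continuousOn hφ
  have hc : ∀ n : ℕ, ContinuousOn (fun ζ => ((starRingEnd ℂ) ζ * z) ^ n * φ ζ)
      (sphere (0 : ℂ) 1) := fun n =>
    (((Complex.continuous_conj.mul continuous_const).pow n).continuousOn).mul hφ'
  have hn : ∀ n : ℕ, ∫ ζ, ‖((starRingEnd ℂ) ζ * z) ^ n * φ ζ‖ ∂circleM =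
      ‖z‖ ^ n * ∫ ζ, ‖φ ζ‖ ∂circleM := fun n => by
    rw [← integral_const_mul]
    refine integral_congr_ae (ae_circleM_of_forall fun ζ hζ => ?_)
    simp [hζ]
  have h := hasSum_integral_of_summable_integral_norm (μ := circleM)
    (F := fun (n : ℕ) ζ => ((starRingEnd ℂ) ζ * z) ^ n * φ ζ)
    (fun n => integrable_circleM (hc n))
    (by simpa only [hn] using (summable_geometric_of_lt_one (norm_nonneg z) hz).mul_right _)
  convert! h using 1
  · ext n
    rw [← integral_mul_const]
    refine integral_congr_ae (ae_of_all _ fun ζ => ?_)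
    simp only [mul_pow]
    ring
  · refine integral_congr_ae (ae_circleM_of_forall fun ζ hζ => ?_)
    simp only
    rw [tsum_mul_right, tsum_geometric_of_norm_lt_one (by simpa [hζ] using hz)]

lemma re_two_mul_kernel_sub_one {z ζ : ℂ} (hz : ‖z‖ < 1) (hζ : ‖ζ‖ = 1) :
    (2 * (1 - (starRingEnd ℂ) ζ * z)⁻¹ - 1).re = discPoisson z ζ := by
  have hne := sub_ne_zero_of_norm hz hζ
  have hζ1 : ζ * (starRingEnd ℂ) ζ = 1 := by simp [Complex.mul_conj, Complex.normSq_eq_norm_sq, hζ]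
  have h1 : ζ * (1 - (starRingEnd ℂ) ζ * z) = ζ - z := by linear_combination -z * hζ1
  have hne' : 1 - (starRingEnd ℂ) ζ * z ≠ 0 := fun h => hne (by rw [← h1, h, mul_zero])
  have h2 : 2 * (1 - (starRingEnd ℂ) ζ * z)⁻¹ - 1 = herglotzRieszKernel 0 z ζ := by
    rw [herglotzRieszKernel_def, sub_zero, sub_zero, eq_div_iff hne, ← h1]
    field_simp
    linear_combination z * hζ1
  rw [h2, ← Function.comp_apply (f := Complex.re) (g := herglotzRieszKernel 0 z),
    ← poissonKernel_eq_re_herglotzRieszKernel, poissonKernel_def]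
  simp [discPoisson, hζ]

lemma re_integral_kernel {φ : ℂ → ℝ} (hφ : ContinuousOn φ (sphere (0 : ℂ) 1)) {z : ℂ}
    (hz : ‖z‖ < 1) :
    (2 * (∫ ζ, (1 - (starRingEnd ℂ) ζ * z)⁻¹ * φ ζ ∂circleM) - ∫ ζ, (φ ζ : ℂ) ∂circleM).re =
      ∫ ζ, discPoisson z ζ * φ ζ ∂circleM := by
  have hφ' : ContinuousOn (fun ζ => (φ ζ : ℂ)) (sphere (0 : ℂ) 1) :=
    Complex.continuous_ofReal.comp_continuousOn hφ
  have hk : ContinuousOn (fun ζ => (1 - (starRingEnd ℂ) ζ * z)⁻¹ * (φ ζ : ℂ))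
      (sphere (0 : ℂ) 1) := by
    refine ContinuousOn.mul (ContinuousOn.inv₀ ?_ fun ζ hζ h0 => ?_) hφ'
    · exact (continuous_const.sub (Complex.continuous_conj.mul continuous_const)).continuousOn
    · have hζ : ‖ζ‖ = 1 := by simpa using hζ
      have := congrArg norm (sub_eq_zero.1 h0)
      simp [hζ] at this
      linarith
  have hInt : Integrable (fun ζ => 2 * ((1 - (starRingEnd ℂ) ζ * z)⁻¹ * (φ ζ : ℂ)) - φ ζ)
      circleM := ((integrable_circleM hk).const_mul 2).sub (integrable_circleM hφ')
  rw [← integral_const_mul, ← integral_sub ((integrable_circleM hk).const_mul 2)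
    (integrable_circleM hφ')]
  rw [← RCLike.re_eq_complex_re, ← integral_re hInt]
  refine integral_congr_ae (ae_circleM_of_forall fun ζ hζ => ?_)
  simp only [RCLike.re_eq_complex_re]
  rw [← re_two_mul_kernel_sub_one hz hζ, ← Complex.re_mul_ofReal]
  congr 1
  ring

lemma differentiableOn_tsum_mul_pow {c : ℕ → ℂ} {B : ℝ} (hc : ∀ n, ‖c n‖ ≤ B) :
    DifferentiableOn ℂ (fun z => ∑' n, c n * z ^ n) (ball (0 : ℂ) 1) := by
  intro z hz
  have hz : ‖z‖ < 1 := by simpa using hz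
  obtain ⟨r, hr, hr1⟩ := exists_between hz
  have hr0 : 0 ≤ r := (norm_nonneg z).trans hr.le
  have hB : 0 ≤ B := (norm_nonneg _).trans (hc 0)
  have h := differentiableOn_tsum_of_summable_norm (F := fun (n : ℕ) (z : ℂ) => c n * z ^ n)
    (u := fun n => B * r ^ n) (U := ball 0 r)
    ((summable_geometric_of_lt_one hr0 hr1).mul_left B) (fun n => by fun_prop) isOpen_ball
    fun n w hw => by
      have hw : ‖w‖ < r := by simpa using hw
      rw [norm_mul, norm_pow]
      gcongr
      exact hc n
  exact (h.differentiableAt (isOpen_ball.mem_nhds (by simpa using hr))).differentiableWithinAt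

/-- A function in `H^p` is dominated by the real part of a holomorphic function. -/
lemma exists_norm_le_re {p : ℝ} (hp : 1 ≤ p) {f : ℂ → ℂ} (hf : MemHp p f) :
    ∃ A : ℂ → ℂ, DifferentiableOn ℂ A (ball (0 : ℂ) 1) ∧ ∀ z : ℂ, ‖z‖ < 1 → ‖f z‖ ≤ (A z).re := by
  set B := 1 + hardyNorm p f ^ p with hB
  set s : ℕ → ℝ := fun k => 1 - 1 / ((k : ℝ) + 1) with hs
  have hs0 : ∀ k, 0 ≤ s k := fun k => by
    have : 1 / ((k : ℝ) + 1) ≤ 1 := by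
      rw [div_le_one (by positivity)]
      linarith [(k.cast_nonneg : (0 : ℝ) ≤ k)]
    simp only [hs]; linarith
  have hs1 : ∀ k, s k < 1 := fun k => by
    have : 0 < 1 / ((k : ℝ) + 1) := by positivity
    simp only [hs]; linarith
  set φ : ℕ → ℂ → ℝ := fun k ζ => ‖f (s k * ζ)‖ with hφ
  have hφc : ∀ k, ContinuousOn (φ k) (sphere (0 : ℂ) 1) := fun k =>
    ((continuousOn_dilate hf.1 (hs0 k) (hs1 k)).mono sphere_subset_closedBall).norm
  have hφB : ∀ k, ∫ ζ, ‖φ k ζ‖ ∂circleM ≤ B := fun k => by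
    have c1 := continuousOn_norm_rpow_dilate hp hf.1 (hs0 k) (hs1 k)
    have h1 := integral_circleM_mono (hφc k).norm (continuousOn_const.add c1)
      (g := fun ζ => 1 + ‖f (s k * ζ)‖ ^ p) fun ζ _ => by
        simp only [hφ, norm_norm]
        rcases le_total ‖f (s k * ζ)‖ 1 with h | h
        · have : 0 ≤ ‖f (s k * ζ)‖ ^ p := by positivity
          linarith
        · have := Real.self_le_rpow_of_one_le h hp
          linarith
    rw [integral_add (integrable_const _) (integrable_circleM c1)] at h1
    have h2 := circleMean_le_hardyNorm_rpow hp hf (hs0 k) (hs1 k)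
    simp only [circleMean, integral_const, probReal_univ, smul_eq_mul, one_mul] at h1 h2
    linarith
  set c : ℕ → ℕ → ℂ := fun k n => ∫ ζ, (starRingEnd ℂ) ζ ^ n * φ k ζ ∂circleM with hc
  have hcB : ∀ k n, ‖c k n‖ ≤ B := fun k n => (norm_moment_le n).trans (hφB k)
  set U : Ultrafilter ℕ := Filter.hyperfilter ℕ
  have hU : (U : Filter ℕ) ≤ Filter.atTop := Nat.hyperfilter_le_atTop
  have hlim : ∀ n, ∃ b : ℂ, ‖b‖ ≤ B ∧ Filter.Tendsto (fun k => c k n) U (nhds b) := fun n => by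
    obtain ⟨b, hb, hbU⟩ := (isCompact_closedBall (0 : ℂ) B).ultrafilter_le_nhds
      (U.map fun k => c k n) (by
        refine Filter.le_principal_iff.2 (Filter.mem_map.2 (Filter.univ_mem' fun k => ?_))
        simpa using hcB k n)
    exact ⟨b, by simpa using hb, hbU⟩
  choose b hbB hb using hlim
  refine ⟨fun z => 2 * (∑' n, b n * z ^ n) - b 0,
    ((differentiableOn_tsum_mul_pow hbB).const_mul 2).sub_const _, fun z hz => ?_⟩
  have hS : Filter.Tendsto (fun k => ∑' n, c k n * z ^ n) U (nhds (∑' n, b n * z ^ n)) :=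
    tendsto_tsum_of_dominated_convergence (bound := fun n => B * ‖z‖ ^ n)
      ((summable_geometric_of_lt_one (norm_nonneg z) hz).mul_left B)
      (fun n => (hb n).mul_const _) (Filter.Eventually.of_forall fun k n => by
        rw [norm_mul, norm_pow]
        exact mul_le_mul_of_nonneg_right (hcB k n) (by positivity))
  have hA := (Complex.continuous_re.tendsto _).comp ((hS.const_mul 2).sub (hb 0))
  have hst : Filter.Tendsto s Filter.atTop (nhds 1) := by
    simpa [hs] using tendsto_one_div_add_atTop_nhds_zero_nat.const_sub (1 : ℝ)
  have hfz : Filter.Tendsto (fun k => ‖f (s k * z)‖) U (nhds ‖f z‖) := by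
    have h1 : Filter.Tendsto (fun k => (s k : ℂ) * z) U (nhds z) := by
      simpa using (((Complex.continuous_ofReal.tendsto 1).comp hst).mul_const z).mono_left hU
    have h2 : ContinuousAt f z :=
      hf.1.continuousOn.continuousAt (isOpen_ball.mem_nhds (by simpa using hz))
    exact (h2.tendsto.comp h1).norm
  refine le_of_tendsto_of_tendsto' hfz hA fun k => ?_
  have h1 := norm_rpow_le_integral_discPoisson le_rfl
    (diffContOnCl_dilate hf.1 (hs0 k) (hs1 k)) hz
  simp only [Real.rpow_one] at h1
  refine h1.trans_eq ?_
  rw [← re_integral_kernel (hφc k) hz, ← (hasSum_moment_mul_pow (hφc k) hz).tsum_eq]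
  simp [hc]

lemma mul_hardyNorm_le {p : ℝ} (hp : 1 ≤ p) {h ψ : ℂ → ℂ} (hh : MemHp p h)
    (hψd : DifferentiableOn ℂ ψ (ball (0 : ℂ) 1))
    (hψm : Set.MapsTo ψ (ball (0 : ℂ) 1) (ball (0 : ℂ) 1))
    {M : ℝ} (hM : 0 < M)
    (hbdd : ∀ f : ℂ → ℂ, MemHp p f → MemHp p (fun z => h z * f (ψ z)) ∧
      hardyNorm p (fun z => h z * f (ψ z)) ≤ M * hardyNorm p f) {C : ℝ} (hC : 0 < C)
    (hker : ∀ w ∈ ball (0 : ℂ) 1, C ≤ hardyNorm p (fun z => h z * ellH p w (ψ z)))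
    {f : ℂ → ℂ} (hf : MemHp p f) :
    C / 2 * hardyNorm p f ≤ hardyNorm p (fun z => h z * f (ψ z)) := by
  have hp0 : 0 < p := by linarith
  set T := hardyNorm p (fun z => h z * f (ψ z)) with hT
  have hT0 : 0 ≤ T := hardyNorm_nonneg
  obtain ⟨A, hAd, hA⟩ := exists_norm_le_re hp hf
  have hden : ∀ {ε : ℝ}, 0 < ε → ∀ z : ℂ, ‖z‖ < 1 → 1 + ε * ‖f z‖ ≤ ‖1 + ε * A z‖ := by
    intro ε hε z hz
    refine le_trans ?_ (Complex.re_le_norm _)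
    simpa using mul_le_mul_of_nonneg_left (hA z hz) hε.le
  have hone : ∀ {ε : ℝ}, 0 < ε → ∀ z : ℂ, ‖z‖ < 1 → 1 ≤ ‖1 + ε * A z‖ := fun hε z hz =>
    le_trans (by nlinarith [norm_nonneg (f z)]) (hden hε z hz)
  have hFd : ∀ {ε : ℝ}, 0 < ε →
      DifferentiableOn ℂ (fun z => f z / (1 + ε * A z)) (ball (0 : ℂ) 1) := fun hε =>
    hf.1.div ((hAd.const_mul _).const_add _) fun z hz h0 => by
      have := hone hε z (by simpa using hz)
      rw [h0, norm_zero] at this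
      linarith
  have hFb : ∀ {ε : ℝ}, 0 < ε → ∀ z : ℂ, ‖z‖ < 1 → ‖f z / (1 + ε * A z)‖ ≤ 1 / ε := by
    intro ε hε z hz
    have h1 := hone hε z hz
    rw [norm_div, div_le_div_iff₀ (by linarith) hε]
    linarith [hden hε z hz]
  have hFH : ∀ {ε : ℝ}, 0 < ε → MemHp p fun z => f z / (1 + ε * A z) := fun hε =>
    memHp_of_bounded hp (hFd hε) (hFb hε)
  have hle : ∀ {ε : ℝ}, 0 < ε → hardyNorm p (fun z => f z / (1 + ε * A z)) ≤ 2 / C * T := by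
    intro ε hε
    have h1 := mul_hardyNorm_le_of_bounded hp hh hψd hψm hM hbdd hC hker (hFd hε) (hFb hε)
    have h2 : hardyNorm p (fun z => h z * (f (ψ z) / (1 + ε * A (ψ z)))) ≤ T := by
      refine hardyNorm_le_of_circleMean_le hp hT0 fun s hs0 hs => ?_
      refine le_trans ?_ (circleMean_le_hardyNorm_rpow hp (hbdd f hf).1 hs0 hs)
      refine integral_circleM_mono
        (continuousOn_norm_rpow_dilate hp (hbdd _ (hFH hε)).1.1 hs0 hs)
        (continuousOn_norm_rpow_dilate hp (hbdd f hf).1.1 hs0 hs) fun ζ hζ => ?_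
      have hz : ‖ψ (s * ζ)‖ < 1 := by
        simpa using hψm (show (s : ℂ) * ζ ∈ ball (0 : ℂ) 1 by
          simpa using norm_mul_lt_one hs0 hs hζ.le)
      refine Real.rpow_le_rpow (norm_nonneg _) ?_ hp0.le
      rw [norm_mul, norm_mul, norm_div]
      exact mul_le_mul_of_nonneg_left (div_le_self (norm_nonneg _) (hone hε _ hz)) (norm_nonneg _)
    have h3 := h1.trans h2
    rw [div_mul_eq_mul_div, le_div_iff₀ hC]
    linarith
  have h2 : hardyNorm p f ≤ 2 / C * T := by
    refine hardyNorm_le_of_circleMean_le hp (by positivity) fun s hs0 hs => ?_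
    obtain ⟨K, hK⟩ := (isCompact_closedBall (0 : ℂ) 1).exists_bound_of_continuousOn
      (continuousOn_dilate hAd hs0 hs)
    have hK0 : 0 ≤ K := (norm_nonneg _).trans (hK 0 (by simp))
    have hlim : Filter.Tendsto (fun ε : ℝ => ((1 + ε * K) * (2 / C * T)) ^ p)
        (nhdsWithin 0 (Set.Ioi 0)) (nhds ((2 / C * T) ^ p)) := by
      have : Continuous fun ε : ℝ => ((1 + ε * K) * (2 / C * T)) ^ p :=
        Continuous.rpow_const (by fun_prop) fun _ => Or.inr hp0.le
      simpa using (this.tendsto 0).mono_left nhdsWithin_le_nhds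
    refine ge_of_tendsto hlim ?_
    filter_upwards [self_mem_nhdsWithin] with ε hε
    have hε : 0 < ε := hε
    have h3 : circleMean p f s ≤
        ∫ ζ, (1 + ε * K) ^ p * ‖f (s * ζ) / (1 + ε * A (s * ζ))‖ ^ p ∂circleM := by
      refine integral_circleM_mono (continuousOn_norm_rpow_dilate hp hf.1 hs0 hs)
        (continuousOn_const.mul (continuousOn_norm_rpow_dilate hp (hFd hε) hs0 hs)) fun ζ hζ => ?_
      rw [← Real.mul_rpow (by positivity) (norm_nonneg _)]
      refine Real.rpow_le_rpow (norm_nonneg _) ?_ hp0.le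
      have h1 := hone hε _ (norm_mul_lt_one hs0 hs hζ.le)
      rw [norm_div, mul_div_assoc', le_div_iff₀ (by linarith), mul_comm]
      refine mul_le_mul_of_nonneg_right ((norm_add_le _ _).trans ?_) (norm_nonneg _)
      rw [norm_one, norm_mul, Complex.norm_real, Real.norm_of_nonneg hε.le]
      gcongr
      exact hK ζ (by simp [hζ])
    rw [integral_const_mul] at h3
    rw [Real.mul_rpow (by positivity) (by positivity)]
    refine h3.trans (mul_le_mul_of_nonneg_left ?_ (by positivity))
    exact (circleMean_le_hardyNorm_rpow hp (hFH hε) hs0 hs).trans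
      (Real.rpow_le_rpow hardyNorm_nonneg (hle hε) hp0.le)
  calc C / 2 * hardyNorm p f ≤ C / 2 * (2 / C * T) := by gcongr
    _ = T := by field_simp

/-- For `1 ≤ p < ∞`, `h ∈ H^p`, `ψ : 𝔻 → 𝔻` holomorphic with `W_{h,ψ}` bounded
on `H^p`: `W_{h,ψ}` is bounded below iff there is `C > 0` with `‖W_{h,ψ} ℓ_w‖_p ≥ C`
for all `w ∈ 𝔻`. -/
theorem statement_3 (p : ℝ) (hp : 1 ≤ p) (h ψ : ℂ → ℂ)
    (hh : MemHp p h)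
    (hψd : DifferentiableOn ℂ ψ (ball (0 : ℂ) 1))
    (hψm : Set.MapsTo ψ (ball (0 : ℂ) 1) (ball (0 : ℂ) 1))
    (hbdd : ∃ M > (0 : ℝ), ∀ f : ℂ → ℂ, MemHp p f →
      MemHp p (fun z => h z * f (ψ z)) ∧
      hardyNorm p (fun z => h z * f (ψ z)) ≤ M * hardyNorm p f) :
    (∃ δ > (0 : ℝ), ∀ f : ℂ → ℂ, MemHp p f →
        δ * hardyNorm p f ≤ hardyNorm p (fun z => h z * f (ψ z))) ↔
    (∃ C > (0 : ℝ), ∀ w ∈ ball (0 : ℂ) 1,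
        C ≤ hardyNorm p (fun z => h z * ellH p w (ψ z))) := by
  obtain ⟨M, hM, hbdd⟩ := hbdd
  constructor
  · rintro ⟨δ, hδ, H⟩
    refine ⟨δ, hδ, fun w hw => ?_⟩
    have hw : ‖w‖ < 1 := by simpa using hw
    refine le_trans ?_ (H _ (memHp_ellH hp hw))
    exact le_mul_of_one_le_right hδ.le (one_le_hardyNorm_ellH hp hw)
  · rintro ⟨C, hC, hker⟩
    exact ⟨C / 2, by positivity, fun f hf =>
      mul_hardyNorm_le hp hh hψd hψm hM hbdd hC hker hf⟩

end
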